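/- Let a : [0,∞) → (0,∞) be a C² solution of the scale-factor equation ä(t) + (4π/3) a(t)^{−2} = 0 with a(0) = 1 and ȧ(0) ≥ √(8π/3), and set E_a = (1/2) ȧ(0)² − 4π/3, so E_a ≥ 0. Then for every t ≥ 0 one has ȧ(t) > 0, a(t) ≥ 1, and 2E_a ≤ ȧ(t)² ≤ 2E_a + 8π/3; consequently 1 + √(2E_a)·t ≤ a(t) ≤ 1 + √(2E_a + 8π/3)·t for all t ≥ 0. -/

import Mathlib

open Real Set

theorem helper_mono (f f' : ℝ → ℝ)
    (hf : ∀ t ∈ Ici (0 : ℝ), HasDerivWithinAt f (f' t) (Ici 0) t)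
    (h : ∀ t ∈ Ici (0 : ℝ), 0 ≤ f' t) : ∀ t ∈ Ici (0 : ℝ), f 0 ≤ f t := by
  have hm : MonotoneOn f (Ici 0) := by
    apply monotoneOn_of_hasDerivWithinAt_nonneg (f' := f') (convex_Ici 0)
    · exact fun t ht => (hf t ht).continuousWithinAt
    · exact fun t ht => (hf t (interior_subset ht)).mono interior_subset
    · exact fun t ht => h t (interior_subset ht)
  intro t ht
  exact hm (by simp) ht ht

/-- Let `a` be a positive C² solution of `ä + (4π/3) a⁻² = 0` on `[0,∞)`
with `a(0) = 1` and `ȧ(0) ≥ √(8π/3)`, and set `E_a = (1/2) ȧ(0)² − 4π/3`. Then `E_a ≥ 0`,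
and for every `t ≥ 0` one has `ȧ(t) > 0`, `a(t) ≥ 1`,
`2 E_a ≤ ȧ(t)² ≤ 2 E_a + 8π/3`, and consequently
`1 + √(2E_a) t ≤ a(t) ≤ 1 + √(2E_a + 8π/3) t`. -/
theorem scale_factor_expansion_bounds
    (a a' a'' : ℝ → ℝ)
    (hpos : ∀ t ∈ Ici (0 : ℝ), 0 < a t)
    (ha : ∀ t ∈ Ici (0 : ℝ), HasDerivWithinAt a (a' t) (Ici 0) t)
    (ha' : ∀ t ∈ Ici (0 : ℝ), HasDerivWithinAt a' (a'' t) (Ici 0) t)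
    (ha'' : ContinuousOn a'' (Ici 0))
    (hODE : ∀ t ∈ Ici (0 : ℝ), a'' t + (4 * π / 3) * (a t) ^ (-2 : ℤ) = 0)
    (ha0 : a 0 = 1)
    (ha'0 : Real.sqrt (8 * π / 3) ≤ a' 0)
    (Ea : ℝ) (hEa : Ea = (1 / 2) * (a' 0) ^ 2 - 4 * π / 3) :
    0 ≤ Ea ∧
    ∀ t ∈ Ici (0 : ℝ),
      0 < a' t ∧ 1 ≤ a t ∧
      2 * Ea ≤ (a' t) ^ 2 ∧ (a' t) ^ 2 ≤ 2 * Ea + 8 * π / 3 ∧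
      1 + Real.sqrt (2 * Ea) * t ≤ a t ∧
      a t ≤ 1 + Real.sqrt (2 * Ea + 8 * π / 3) * t := by
  have hpi := Real.pi_pos
  have hsq : 8 * π / 3 ≤ (a' 0) ^ 2 := by
    have h1 := Real.sq_sqrt (show 0 ≤ 8 * π / 3 by positivity)
    have h2 := Real.sqrt_nonneg (8 * π / 3)
    nlinarith
  have hE0 : 0 ≤ Ea := by rw [hEa]; linarith
  have ha'0pos : 0 < a' 0 := lt_of_lt_of_le (Real.sqrt_pos.mpr (by positivity)) ha'0
  have hder : ∀ t ∈ Ici (0 : ℝ),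
      HasDerivWithinAt (fun s => (a' s) ^ 2 - (8 * π / 3) * (a s)⁻¹) 0 (Ici 0) t := by
    intro t ht
    have hp := hpos t ht
    have h := ((ha' t ht).pow 2).sub (((ha t ht).inv hp.ne').const_mul (8 * π / 3))
    refine h.congr_deriv ?_
    have ho := hODE t ht
    have e : a'' t = - ((4 * π / 3) * (a t ^ 2)⁻¹) := by
      rw [zpow_neg] at ho
      have : a t ^ (2 : ℤ) = a t ^ 2 := by norm_cast
      rw [this] at ho
      linarith
    rw [e]
    field_simp
    norm_num
    try ring
  have hen : ∀ t ∈ Ici (0 : ℝ), (a' t) ^ 2 = 2 * Ea + (8 * π / 3) * (a t)⁻¹ := by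
    intro t ht
    have h1 := helper_mono _ (fun _ => 0) hder (fun _ _ => le_rfl) t ht
    have h2 := helper_mono _ (fun _ => -0) (fun t ht => (hder t ht).neg) (by simp) t ht
    simp only [ha0, Pi.neg_apply] at h1 h2
    rw [hEa]
    linarith
  have hcont : ContinuousOn a' (Ici 0) := fun t ht => (ha' t ht).continuousWithinAt
  have hpos' : ∀ t ∈ Ici (0 : ℝ), 0 < a' t := by
    intro t ht
    by_contra hn
    push Not at hn
    obtain ⟨s, hs, hs0⟩ := intermediate_value_Icc' (mem_Ici.mp ht)
      (hcont.mono Icc_subset_Ici_self) ⟨hn, ha'0pos.le⟩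
    have hs' : s ∈ Ici (0 : ℝ) := hs.1
    have h := hen s hs'
    have hp := hpos s hs'
    have : 0 < (8 * π / 3) * (a s)⁻¹ := by positivity
    rw [hs0] at h
    linarith
  have h1 : ∀ t ∈ Ici (0 : ℝ), 1 ≤ a t := by
    intro t ht
    have := helper_mono a a' ha (fun t ht => (hpos' t ht).le) t ht
    rwa [ha0] at this
  have hlo : ∀ t ∈ Ici (0 : ℝ), 2 * Ea ≤ (a' t) ^ 2 := by
    intro t ht
    have hp := hpos t ht
    have : 0 < (8 * π / 3) * (a t)⁻¹ := by positivity
    rw [hen t ht]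
    linarith
  have hhi : ∀ t ∈ Ici (0 : ℝ), (a' t) ^ 2 ≤ 2 * Ea + 8 * π / 3 := by
    intro t ht
    have h2 : (a t)⁻¹ ≤ 1 := inv_le_one_of_one_le₀ (h1 t ht)
    have : (8 * π / 3) * (a t)⁻¹ ≤ 8 * π / 3 := mul_le_of_le_one_right (by positivity) h2
    rw [hen t ht]
    linarith
  refine ⟨hE0, fun t ht => ⟨hpos' t ht, h1 t ht, hlo t ht, hhi t ht, ?_, ?_⟩⟩
  · have h := helper_mono (fun s => a s - Real.sqrt (2 * Ea) * s)
      (fun s => a' s - Real.sqrt (2 * Ea) * 1)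
      (fun s hs => (ha s hs).sub ((hasDerivWithinAt_id s _).const_mul _))
      (fun s hs => by
        have := Real.sqrt_le_iff.mpr ⟨(hpos' s hs).le, hlo s hs⟩
        linarith) t ht
    simp only [ha0] at h
    linarith
  · have h := helper_mono (fun s => Real.sqrt (2 * Ea + 8 * π / 3) * s - a s)
      (fun s => Real.sqrt (2 * Ea + 8 * π / 3) * 1 - a' s)
      (fun s hs => ((hasDerivWithinAt_id s _).const_mul _).sub (ha s hs))
      (fun s hs => by
        have := Real.le_sqrt_of_sq_le (hhi s hs)
        linarith) t ht
    simp only [ha0] at h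
    linarith
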